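/- Let P be a polygonal face with w sides in a planar 4-valent graph G. Then no two distinct sides of P are the same edge of G. -/

import Mathlib

/-- The number of cycles of a permutation (counting fixed points as 1-cycles). -/
def numCycles {D : Type} [Fintype D] [DecidableEq D] (p : Equiv.Perm D) : ℕ :=
  p.cycleType.card + Fintype.card {x // p x = x}

section NumCycles

variable {D : Type}

open Equiv.Perm

/-- The rational functions on `D` that are invariant under the permutation `p`. -/
def invariantFunctions (p : Equiv.Perm D) : Submodule ℚ (D → ℚ) where
  carrier := {f | ∀ x, f (p x) = f x}
  add_mem' hf hg x := by simp [hf x, hg x]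
  zero_mem' x := rfl
  smul_mem' c f hf x := by simp [hf x]

theorem mem_invariantFunctions {p : Equiv.Perm D} {f : D → ℚ} :
    f ∈ invariantFunctions p ↔ ∀ x, f (p x) = f x := Iff.rfl

theorem eq_of_sameCycle_of_mem_invariantFunctions {p : Equiv.Perm D} {f : D → ℚ}
    (hf : f ∈ invariantFunctions p) {x y : D} (h : p.SameCycle x y) : f x = f y := by
  obtain ⟨i, rfl⟩ := h
  induction i using Int.induction_on with
  | zero => simp
  | succ i ih => rw [add_comm, zpow_add, zpow_one, mul_apply, hf, ih]
  | pred i ih =>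
    rw [ih, ← hf ((p ^ (-(i : ℤ) - 1)) x), ← mul_apply, ← zpow_one_add]
    congr 3
    ring

variable [Fintype D] [DecidableEq D]

theorem numCycles_eq_card_quotient (p : Equiv.Perm D) :
    numCycles p = Nat.card (Quotient (SameCycle.setoid p)) := by
  let F : D → p.cycleFactorsFinset ⊕ {x // p x = x} := fun x =>
    if h : p x = x then Sum.inr ⟨x, h⟩
    else Sum.inl ⟨p.cycleOf x, cycleOf_mem_cycleFactorsFinset_iff.2 (mem_support.2 h)⟩
  have hF : Function.Surjective F := by
    rintro (⟨c, hc⟩ | ⟨x, hx⟩)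
    · obtain ⟨x, hx⟩ := (mem_cycleFactorsFinset_iff.1 hc).1.nonempty_support
      have hpx : p x ≠ x := by
        rw [← (mem_cycleFactorsFinset_iff.1 hc).2 x hx]
        exact mem_support.1 hx
      refine ⟨x, ?_⟩
      simp only [F, dif_neg hpx]
      congr 2
      exact (cycle_is_cycleOf hx hc).symm
    · exact ⟨x, by simp [F, hx]⟩
  have hker : SameCycle.setoid p = Setoid.ker F := by
    ext x y
    change p.SameCycle x y ↔ F x = F y
    by_cases hx : p x = x <;> by_cases hy : p y = y
    · simp only [F, dif_pos hx, dif_pos hy, Sum.inr.injEq, Subtype.mk.injEq]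
      exact ⟨fun h => (h.eq_of_left hx), fun h => h ▸ SameCycle.refl _ _⟩
    · simp only [F, dif_pos hx, dif_neg hy, reduceCtorEq, iff_false]
      exact fun h => hy (h.apply_eq_self_iff.1 hx)
    · simp only [F, dif_neg hx, dif_pos hy, reduceCtorEq, iff_false]
      exact fun h => hx (h.apply_eq_self_iff.2 hy)
    · simp only [F, dif_neg hx, dif_neg hy, Sum.inl.injEq, Subtype.mk.injEq]
      refine ⟨fun h => h.cycleOf_eq, fun h => ?_⟩
      have : y ∈ (p.cycleOf x).support := by
        rw [h, mem_support_cycleOf_iff]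
        exact ⟨SameCycle.refl _ _, mem_support.2 hy⟩
      exact (mem_support_cycleOf_iff.1 this).1
  rw [hker, Nat.card_congr (Setoid.quotientKerEquivOfSurjective F hF), Nat.card_sum,
    numCycles, cycleType_def]
  simp

theorem finrank_invariantFunctions (p : Equiv.Perm D) :
    Module.finrank ℚ (invariantFunctions p) = numCycles p := by
  classical
  let e : (Quotient (SameCycle.setoid p) → ℚ) ≃ₗ[ℚ] invariantFunctions p :=
    { toFun := fun g => ⟨fun x => g (Quotient.mk _ x), fun x =>
        congrArg g (Quotient.sound (sameCycle_apply_left.2 (SameCycle.refl p x)))⟩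
      invFun := fun f => Quotient.lift f.1 fun _ _ h =>
        eq_of_sameCycle_of_mem_invariantFunctions f.2 h
      map_add' := fun _ _ => rfl
      map_smul' := fun _ _ => rfl
      left_inv := fun g => by
        ext q
        induction q using Quotient.inductionOn
        rfl
      right_inv := fun f => rfl }
  rw [← e.finrank_eq, numCycles_eq_card_quotient, Module.finrank_pi, Nat.card_eq_fintype_card]

theorem card_support_add_card_fixed (p : Equiv.Perm D) :
    p.support.card + Fintype.card {x // p x = x} = Fintype.card D := by
  rw [Fintype.card_subtype, support, add_comm]
  exact Finset.card_filter_add_card_filter_not _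

theorem sign_eq_neg_one_pow_numCycles (p : Equiv.Perm D) :
    sign p = (-1) ^ (Fintype.card D + numCycles p) := by
  rw [sign_of_cycleType, sum_cycleType, ← card_support_add_card_fixed p, numCycles]
  have : p.support.card + Fintype.card {x // p x = x} +
      (p.cycleType.card + Fintype.card {x // p x = x}) =
      (p.support.card + p.cycleType.card) + 2 * Fintype.card {x // p x = x} := by ring
  rw [this, pow_add _ _ (2 * _), pow_mul]
  simp

/-- Multiplying by the transposition of two points of one cycle splits cycles. -/
theorem numCycles_lt_numCycles_mul_swap {p : Equiv.Perm D} {x y : D} (hxy : x ≠ y)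
    (h : p.SameCycle x y) : numCycles p < numCycles (p * Equiv.swap x y) := by
  have hle : numCycles p ≤ numCycles (p * Equiv.swap x y) := by
    rw [← finrank_invariantFunctions, ← finrank_invariantFunctions]
    refine Submodule.finrank_mono fun f hf z => ?_
    have hfxy := eq_of_sameCycle_of_mem_invariantFunctions hf h
    rw [mul_apply, hf]
    rcases eq_or_ne z x with rfl | hzx
    · simp [hfxy]
    rcases eq_or_ne z y with rfl | hzy
    · simp [hfxy]
    rw [Equiv.swap_apply_of_ne_of_ne hzx hzy]
  refine lt_of_le_of_ne hle fun heq => ?_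
  have hs : sign (p * Equiv.swap x y) = sign p := by
    rw [sign_eq_neg_one_pow_numCycles, sign_eq_neg_one_pow_numCycles, heq]
  rw [Equiv.Perm.sign_mul, sign_swap hxy, mul_neg_one] at hs
  exact units_ne_neg_self _ hs.symm

theorem card_le_two_mul_numCycles {p : Equiv.Perm D} (hp : p * p = 1) :
    Fintype.card D ≤ 2 * numCycles p := by
  have hsum : p.cycleType.sum ≤ p.cycleType.card • 2 := by
    refine Multiset.sum_le_card_nsmul _ _ fun k hk => ?_
    have : orderOf p ∣ 2 := orderOf_dvd_of_pow_eq_one (by rw [pow_two, hp])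
    exact Nat.le_of_dvd two_pos ((dvd_of_mem_cycleType hk).trans this)
  rw [sum_cycleType, smul_eq_mul] at hsum
  rw [← card_support_add_card_fixed p, numCycles]
  omega

/-- The genus of a connected pair of permutations is nonnegative. -/
theorem numCycles_add_numCycles_add_numCycles_mul_le (σ α : Equiv.Perm D)
    (h : ∀ f ∈ invariantFunctions σ ⊓ invariantFunctions α, ∀ x y, f x = f y) :
    numCycles σ + numCycles α + numCycles (σ * α) ≤ Fintype.card D + 2 := by
  have hone : Module.finrank ℚ (invariantFunctions σ ⊓ invariantFunctions α :
      Submodule ℚ (D → ℚ)) ≤ 1 := by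
    refine le_trans (Submodule.finrank_mono (t := Submodule.span ℚ {fun _ => (1 : ℚ)})
      fun f hf => ?_) ((finrank_span_le_card _).trans (by simp))
    rw [Submodule.mem_span_singleton]
    rcases isEmpty_or_nonempty D with hD | ⟨⟨x⟩⟩
    · exact ⟨0, Subsingleton.elim _ _⟩
    · exact ⟨f x, funext fun y => by simp [h f hf x y]⟩
  let T : (D → ℚ) →ₗ[ℚ] (D → ℚ) := LinearMap.funLeft ℚ ℚ σ - LinearMap.id
  have hT : ∀ f x, T f x = f (σ x) - f x := fun f x => rfl
  let S := T.domRestrict (invariantFunctions (σ * α))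
  have hker : Module.finrank ℚ (LinearMap.ker S) ≤ 1 := by
    refine le_trans ?_ hone
    rw [← Submodule.finrank_map_subtype_eq (invariantFunctions (σ * α)) (LinearMap.ker S)]
    refine Submodule.finrank_mono ?_
    rintro _ ⟨⟨f, hf⟩, hfS, rfl⟩
    have hfσ : ∀ x, f (σ x) = f x := fun x => sub_eq_zero.1 (congrFun hfS x)
    exact ⟨hfσ, fun x => (hfσ (α x)).symm.trans (hf x)⟩
  have hdisj : Disjoint (LinearMap.range S) (invariantFunctions σ ⊔ invariantFunctions α) := by
    rw [Submodule.disjoint_def]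
    rintro _ ⟨⟨f, hf⟩, rfl⟩ hw
    have hfα : ∀ x, f (σ x) = f (α⁻¹ x) := fun x => by simpa using hf (α⁻¹ x)
    have horth : ∀ u ∈ invariantFunctions σ ⊔ invariantFunctions α, T f ⬝ᵥ u = 0 := by
      intro u hu
      obtain ⟨a, ha, b, hb, rfl⟩ := Submodule.mem_sup.1 hu
      have h1 : T f ⬝ᵥ a = 0 := by
        simp only [dotProduct, hT, sub_mul, Finset.sum_sub_distrib]
        rw [sub_eq_zero, ← Equiv.sum_comp σ fun x => f x * a x]
        simp only [ha _]
      have h2 : T f ⬝ᵥ b = 0 := by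
        simp only [dotProduct, hT, sub_mul, Finset.sum_sub_distrib, hfα]
        rw [sub_eq_zero, ← Equiv.sum_comp α fun x => f (α⁻¹ x) * b x]
        simp [hb _]
      rw [dotProduct_add, h1, h2, add_zero]
    exact dotProduct_self_eq_zero.1 (horth _ hw)
  have h1 := Submodule.finrank_add_finrank_le_of_disjoint hdisj
  have h2 := Submodule.finrank_sup_add_finrank_inf_eq (invariantFunctions σ) (invariantFunctions α)
  have h3 := LinearMap.finrank_range_add_finrank_ker S
  simp only [finrank_invariantFunctions, Module.finrank_pi] at h1 h2 h3
  omega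

end NumCycles

/-- no face of a planar (spherical) 4-valent graph traverses an edge
twice. The plane graph is modelled as a combinatorial map on a finite set `D` of
darts: a fixed-point-free involution `α` pairing the two darts of each edge, a
vertex-rotation permutation `σ` all of whose cycles have length exactly 4
(4-valence), connectivity, and the Euler formula
`#vertices - #edges + #faces = 2`, where faces are the cycles of `σ * α`. The
conclusion: no dart `d` lies on the same face cycle as its partner `α d`, i.e.
no two sides of a face are the same edge. -/
theorem face_traverses_no_edge_twice {D : Type} [Fintype D] [DecidableEq D]
    (σ α : Equiv.Perm D)
    (hinv : α * α = 1) (hnf : ∀ d, α d ≠ d)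
    (h4 : ∀ d : D, (σ ^ 4) d = d ∧ σ d ≠ d ∧ (σ ^ 2) d ≠ d)
    (hconn : ∀ d d' : D, ∃ g ∈ Subgroup.closure ({σ, α} : Set (Equiv.Perm D)), g d = d')
    (heuler : numCycles σ + numCycles (σ * α) = numCycles α + 2) :
    ∀ d : D, ¬ (σ * α).SameCycle d (α d) := by
  intro d hd
  have hαα : ∀ x, α (α x) = x := fun x => by rw [← Equiv.Perm.mul_apply, hinv]; rfl
  have hedge := numCycles_lt_numCycles_mul_swap (hnf d).symm
    (Equiv.Perm.sameCycle_apply_right.2 (Equiv.Perm.SameCycle.refl α d))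
  have hface := numCycles_lt_numCycles_mul_swap (hnf d).symm hd
  have hcard := card_le_two_mul_numCycles hinv
  have hgenus := numCycles_add_numCycles_add_numCycles_mul_le σ (α * Equiv.swap d (α d)) ?_
  · rw [← mul_assoc] at hgenus
    omega
  rintro f ⟨hfσ, hfα'⟩
  have hfα : ∀ x, x ≠ d → x ≠ α d → f (α x) = f x := fun x hx hx' => by
    simpa [Equiv.swap_apply_of_ne_of_ne hx hx'] using hfα' x
  -- An invariant function separating the two ends of the edge contradicts parity.
  have hends : f (α d) = f d := by
    by_contra hne
    let O : Finset D := {x | f x = f d}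
    have hO : ∀ x, x ∈ O ↔ f x = f d := fun x => by simp [O]
    have heven : ∑ _x ∈ O, (1 : ZMod 2) = 0 := by
      refine Finset.sum_involution (fun x _ => (σ ^ 2) x) (fun _ _ => by decide)
        (fun x _ _ => (h4 x).2.2) (fun x hx => ?_) (fun x _ => ?_)
      · rw [hO] at hx ⊢
        rw [pow_two, Equiv.Perm.mul_apply, hfσ, hfσ, hx]
      · rw [← Equiv.Perm.mul_apply, ← pow_add]
        exact (h4 x).1
    have hodd : ∑ _x ∈ O.erase d, (1 : ZMod 2) = 0 := by
      refine Finset.sum_involution (fun x _ => α x) (fun _ _ => by decide)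
        (fun x _ _ => hnf x) (fun x hx => ?_) (fun x _ => hαα x)
      rw [Finset.mem_erase, hO] at hx ⊢
      have hx' : x ≠ α d := fun h => hne (h ▸ hx.2)
      exact ⟨fun h => hx' (by rw [← h, hαα]), (hfα x hx.1 hx').trans hx.2⟩
    have hsplit := Finset.add_sum_erase O (fun _ => (1 : ZMod 2)) ((hO d).2 rfl)
    rw [heven, hodd] at hsplit
    exact absurd hsplit (by decide)
  have hfα_all : ∀ x, f (α x) = f x := fun x => by
    by_cases hx : x = d
    · rw [hx, hends]
    by_cases hx' : x = α d
    · rw [hx', hαα, hends]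
    exact hfα x hx hx'
  have hinvariant : ∀ g ∈ Subgroup.closure ({σ, α} : Set (Equiv.Perm D)), ∀ x, f (g x) = f x := by
    intro g hg
    induction hg using Subgroup.closure_induction with
    | mem g hg =>
      rcases hg with rfl | rfl
      exacts [hfσ, hfα_all]
    | one => exact fun _ => rfl
    | mul a b _ _ ha hb => exact fun x => by rw [Equiv.Perm.mul_apply, ha, hb]
    | inv a _ ha =>
      intro x
      rw [← ha (a⁻¹ x), ← Equiv.Perm.mul_apply, mul_inv_cancel, Equiv.Perm.one_apply]
  intro x y
  obtain ⟨g, hg, rfl⟩ := hconn x y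
  exact (hinvariant g hg x).symm
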